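/- arXiv:2009.02027 — 2 statements merged into one kernel-verified Lean document; each statement's English description precedes it below -/
import Mathlib

section
/- Let G be a connected finite simple graph on N vertices, let A' = A + I be its adjacency matrix with self-loops added, D' the diagonal matrix with D'_ii = ∑_j A'_ij, and Â = (D')⁻¹A'. Then for every Z ∈ ℝ^{N×C} the sequence of matrices Â^k Z converges as k → ∞ to a matrix Z̃ ∈ ℝ^{N×C} all of whose rows are equal, i.e., z̃₁ = z̃₂ = ⋯ = z̃_N; in other words, applying graph convolution infinitely to a graph with self-loops produces the same output vector for every node. -/
open Matrix BigOperators Finset Filter Topology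

namespace Matrix

variable {n : Type*} [Fintype n] [DecidableEq n] {M P : Matrix n n ℝ}

/-- A row-stochastic matrix whose `(i, j)` entry is at least `ε` moves any lower bound of a vector
towards its `j`-th coordinate. -/
lemma le_mulVec_of_mem_rowStochastic (hM : M ∈ rowStochastic ℝ n) {ε a : ℝ} {v : n → ℝ}
    {i j : n} (hε : ε ≤ M i j) (hv : ∀ l, a ≤ v l) :
    (1 - ε) * a + ε * v j ≤ (M *ᵥ v) i := by
  have hsum : ∑ l, M i l * (v l - a) = (M *ᵥ v) i - a := by
    simp only [mul_sub, Finset.sum_sub_distrib, ← Finset.sum_mul,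
      sum_row_of_mem_rowStochastic hM, one_mul]
    rfl
  have hterm : M i j * (v j - a) ≤ ∑ l, M i l * (v l - a) :=
    Finset.single_le_sum (f := fun l => M i l * (v l - a))
      (fun l _ => mul_nonneg (nonneg_of_mem_rowStochastic hM) (sub_nonneg.2 (hv l)))
      (Finset.mem_univ j)
  have := mul_le_mul_of_nonneg_right hε (sub_nonneg.2 (hv j))
  linarith

/-- A row-stochastic matrix whose `(i, j)` entry is at least `ε` moves any upper bound of a vector
towards its `j`-th coordinate. -/
lemma mulVec_le_of_mem_rowStochastic (hM : M ∈ rowStochastic ℝ n) {ε b : ℝ} {v : n → ℝ}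
    {i j : n} (hε : ε ≤ M i j) (hv : ∀ l, v l ≤ b) :
    (M *ᵥ v) i ≤ (1 - ε) * b + ε * v j := by
  have := le_mulVec_of_mem_rowStochastic hM (a := -b) (v := -v) hε (fun l => neg_le_neg (hv l))
  rw [mulVec_neg] at this
  simp only [Pi.neg_apply] at this
  linarith

lemma mulVec_mem_Icc_of_mem_rowStochastic (hM : M ∈ rowStochastic ℝ n) {a b : ℝ} {v : n → ℝ}
    (hv : ∀ i, v i ∈ Set.Icc a b) (i : n) : (M *ᵥ v) i ∈ Set.Icc a b := by
  have h0 : (0 : ℝ) ≤ M i i := nonneg_of_mem_rowStochastic hM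
  have h₁ := le_mulVec_of_mem_rowStochastic hM h0 (fun l => (hv l).1)
  have h₂ := mulVec_le_of_mem_rowStochastic hM h0 (fun l => (hv l).2)
  constructor <;> linarith

/-- If all entries of the `m`-th power of a row-stochastic matrix `P` are at least `ε`, then all
coordinates of `P ^ k *ᵥ v` with `k ≥ m * r` lie in an interval of length `O((1 - ε) ^ r)`. -/
lemma exists_Icc_pow_mulVec [Nonempty n] (hP : P ∈ rowStochastic ℝ n) {m : ℕ} {ε : ℝ}
    (hε : ∀ i j, ε ≤ (P ^ m) i j) {a b : ℝ} {v : n → ℝ} (hv : ∀ i, v i ∈ Set.Icc a b) (r : ℕ) :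
    ∃ a' b' : ℝ, b' - a' = (1 - ε) ^ r * (b - a) ∧
      ∀ k, m * r ≤ k → ∀ i, (P ^ k *ᵥ v) i ∈ Set.Icc a' b' := by
  induction r with
  | zero =>
    exact ⟨a, b, by simp, fun k _ => mulVec_mem_Icc_of_mem_rowStochastic (pow_mem hP k) hv⟩
  | succ r ih =>
    obtain ⟨a', b', hab, h⟩ := ih
    set w := P ^ (m * r) *ᵥ v with hw
    have hwI := h (m * r) le_rfl
    let j : n := Classical.arbitrary n
    refine ⟨(1 - ε) * a' + ε * w j, (1 - ε) * b' + ε * w j, ?_, fun k hk => ?_⟩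
    · rw [pow_succ', mul_assoc, ← hab]
      ring
    · obtain ⟨l, rfl⟩ := Nat.exists_eq_add_of_le' hk
      have hsplit : P ^ (l + m * (r + 1)) *ᵥ v = P ^ l *ᵥ (P ^ m *ᵥ w) := by
        rw [hw, mulVec_mulVec, mulVec_mulVec, ← pow_add, ← pow_add]
        congr 2
        ring
      rw [hsplit]
      exact mulVec_mem_Icc_of_mem_rowStochastic (pow_mem hP l) fun i =>
        ⟨le_mulVec_of_mem_rowStochastic (pow_mem hP m) (hε i j) fun l => (hwI l).1,
          mulVec_le_of_mem_rowStochastic (pow_mem hP m) (hε i j) fun l => (hwI l).2⟩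

/-- The iterates of a primitive row-stochastic matrix on a vector converge to a constant vector. -/
theorem IsPrimitive.exists_tendsto_pow_mulVec [Nonempty n] (hprim : P.IsPrimitive)
    (hP : P ∈ rowStochastic ℝ n) (v : n → ℝ) :
    ∃ c : ℝ, ∀ i, Tendsto (fun k : ℕ => (P ^ k *ᵥ v) i) atTop (𝓝 c) := by
  obtain ⟨m, -, hm⟩ := hprim.exists_pos_pow
  obtain ⟨p, hp⟩ := Finite.exists_min fun p : n × n => (P ^ m) p.1 p.2
  set ε := (P ^ m) p.1 p.2
  have hε : 0 < ε := hm _ _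
  have hε1 : ε ≤ 1 := le_one_of_mem_rowStochastic (pow_mem hP m)
  obtain ⟨ia, ha⟩ := Finite.exists_min v
  obtain ⟨ib, hb⟩ := Finite.exists_max v
  have hosc := exists_Icc_pow_mulVec hP (fun i j => hp (i, j)) (fun i => ⟨ha i, hb i⟩)
  have hlim : Tendsto (fun r : ℕ => (1 - ε) ^ r * (v ib - v ia)) atTop (𝓝 0) := by
    simpa using (tendsto_pow_atTop_nhds_zero_of_lt_one (sub_nonneg.2 hε1)
      (sub_lt_self 1 hε)).mul_const (v ib - v ia)
  have hclose : ∀ δ > 0, ∃ K, ∀ k ≥ K, ∀ l ≥ K, ∀ i j,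
      dist ((P ^ k *ᵥ v) i) ((P ^ l *ᵥ v) j) < δ := by
    intro δ hδ
    obtain ⟨r, hr⟩ := (hlim.eventually_lt_const hδ).exists
    obtain ⟨a', b', hab, h⟩ := hosc r
    exact ⟨m * r, fun k hk l hl i j =>
      (Real.dist_le_of_mem_Icc (h k hk i) (h l hl j)).trans_lt (hab ▸ hr)⟩
  let j : n := Classical.arbitrary n
  obtain ⟨c, hc⟩ := cauchySeq_tendsto_of_complete (u := fun k : ℕ => (P ^ k *ᵥ v) j) <|
    Metric.cauchySeq_iff.2 fun δ hδ => (hclose δ hδ).imp fun K hK k hk l hl => hK k hk l hl j j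
  refine ⟨c, fun i => hc.congr_dist <| Metric.tendsto_atTop.2 fun δ hδ => ?_⟩
  obtain ⟨K, hK⟩ := hclose δ hδ
  exact ⟨K, fun k hk => by simpa [Real.dist_eq] using hK k hk k hk j i⟩

/-- A nonnegative matrix with positive diagonal and positive entries along the edges of a connected
graph is primitive. -/
theorem isPrimitive_of_connected {G : SimpleGraph n} (hG : G.Connected)
    (hnonneg : ∀ i j, 0 ≤ P i j) (hdiag : ∀ i, 0 < P i i)
    (hadj : ∀ i j, G.Adj i j → 0 < P i j) : P.IsPrimitive := by
  have hmul : ∀ k i j l, 0 < P i j → 0 < (P ^ k) j l → 0 < (P ^ (k + 1)) i l := by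
    intro k i j l hij hjl
    rw [pow_succ', mul_apply]
    exact (mul_pos hij hjl).trans_le <| Finset.single_le_sum
      (f := fun q => P i q * (P ^ k) q l)
      (fun q _ => mul_nonneg (hnonneg i q) (pow_apply_nonneg hnonneg k q l)) (Finset.mem_univ j)
  have hwalk : ∀ {i j} (w : G.Walk i j) d, 0 < (P ^ (d + w.length)) i j := by
    intro i j w d
    induction d with
    | zero =>
      rw [zero_add]
      induction w with
      | nil => simp
      | cons h w ih => exact hmul _ _ _ _ (hadj _ _ h) ih
    | succ d ih =>
      rw [Nat.add_right_comm]
      exact hmul _ _ _ _ (hdiag _) ih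
  have := hG.nonempty
  refine ⟨hnonneg, Fintype.card n, Fintype.card_pos, fun i j => ?_⟩
  obtain ⟨w, hw⟩ := hG.preconnected.exists_isPath i j
  simpa [Nat.sub_add_cancel hw.length_lt.le] using hwalk w (Fintype.card n - w.length)

end Matrix

/-- Let `G` be a connected finite simple graph on `N` vertices, `A' = A + I`
its adjacency matrix with self-loops, `D'` the diagonal matrix of row sums of `A'`, and
`Â = (D')⁻¹A'`. Then for every `Z ∈ ℝ^{N×C}`, the sequence `Â^k Z` converges (entrywise) as
`k → ∞` to a matrix `Z̃` all of whose rows are equal: applying graph convolution infinitely to a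
graph with self-loops produces the same output vector for every node. -/
theorem infinite_graph_convolution_rows_equal
    (N C : ℕ) (G : SimpleGraph (Fin N)) [DecidableRel G.Adj]
    (hconn : G.Connected)
    (A : Matrix (Fin N) (Fin N) ℝ) (hA : A = G.adjMatrix ℝ)
    (A' : Matrix (Fin N) (Fin N) ℝ) (hA' : A' = A + 1)
    (D' : Matrix (Fin N) (Fin N) ℝ) (hD' : D' = Matrix.diagonal (fun i => ∑ j, A' i j))
    (Ahat : Matrix (Fin N) (Fin N) ℝ) (hAhat : Ahat = D'⁻¹ * A')
    (Z : Matrix (Fin N) (Fin C) ℝ) :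
    ∃ Ztilde : Matrix (Fin N) (Fin C) ℝ,
      (∀ i i', Ztilde i = Ztilde i')
      ∧ Tendsto (fun k : ℕ => Ahat ^ k * Z) atTop (𝓝 Ztilde) := by
  have := hconn.nonempty
  have hAdj : ∀ i j, A' i j = (if G.Adj i j then 1 else 0) + (if i = j then 1 else 0) := by
    intro i j
    simp [hA', hA, SimpleGraph.adjMatrix_apply, Matrix.one_apply]
  have hnonneg : ∀ i j, 0 ≤ A' i j := by
    intro i j
    rw [hAdj]
    positivity
  have hdiag : ∀ i, 0 < A' i i := fun i => by simp [hAdj]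
  have hdeg : ∀ i, 0 < ∑ j, A' i j := fun i =>
    Finset.sum_pos' (fun j _ => hnonneg i j) ⟨i, Finset.mem_univ i, hdiag i⟩
  have hentry : ∀ i j, Ahat i j = (∑ l, A' i l)⁻¹ * A' i j := by
    intro i j
    have hinv : D'⁻¹ = Matrix.diagonal fun i => (∑ l, A' i l)⁻¹ := by
      refine Matrix.inv_eq_left_inv ?_
      rw [hD', Matrix.diagonal_mul_diagonal, ← Matrix.diagonal_one]
      exact congrArg _ (funext fun i => inv_mul_cancel₀ (hdeg i).ne')
    rw [hAhat, hinv, Matrix.diagonal_mul]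
  have hstoch : Ahat ∈ rowStochastic ℝ (Fin N) := by
    refine mem_rowStochastic_iff_sum.2 ⟨fun i j => ?_, fun i => ?_⟩
    · rw [hentry]
      exact mul_nonneg (inv_nonneg.2 (hdeg i).le) (hnonneg i j)
    · simp_rw [hentry, ← Finset.mul_sum]
      exact inv_mul_cancel₀ (hdeg i).ne'
  have hprim : Ahat.IsPrimitive := by
    refine isPrimitive_of_connected hconn hstoch.1 (fun i => ?_) (fun i j hij => ?_)
    · rw [hentry]
      exact mul_pos (inv_pos.2 (hdeg i)) (hdiag i)
    · rw [hentry]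
      exact mul_pos (inv_pos.2 (hdeg i)) (by simp [hAdj, hij, hij.ne])
  choose c hc using fun j => hprim.exists_tendsto_pow_mulVec hstoch (Z.col j)
  exact ⟨Matrix.of fun _ j => c j, fun _ _ => rfl,
    tendsto_pi_nhds.2 fun i => tendsto_pi_nhds.2 fun j => hc j i⟩
end

section
/- Let G be a connected finite simple graph on N vertices and let A' = A + I, D' the diagonal matrix with D'_ii = ∑_j A'_ij, Â = (D')⁻¹A', and define the GCN layer with identity weights L(Z) = ReLU(ÂZ) (entrywise max(0,·)). Then for every Z ∈ ℝ^{N×C} with nonnegative entries, the iterates L^k(Z) converge as k → ∞ to a matrix Z̃ all of whose rows are equal; that is, an infinite-depth GCN with identity linear mappings makes every node's output vector identical. -/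
open Matrix BigOperators Finset Filter Topology

section RowStochastic

variable {n : Type*} [Fintype n] [DecidableEq n] {P : Matrix n n ℝ}

/-- Averaging against a weight vector bounded below by `δ` pulls the value below the upper bound
by `δ` times the gap to any entry. -/
lemma Matrix.mulVec_le_sub_of_mem_rowStochastic (hP : P ∈ rowStochastic ℝ n) {δ M : ℝ}
    (hδ : ∀ i j, δ ≤ P i j) {v : n → ℝ} (hv : ∀ j, v j ≤ M) (i j : n) :
    (P *ᵥ v) i ≤ M - δ * (M - v j) := by
  have hrow : ∑ l, P i l = 1 := sum_row_of_mem_rowStochastic hP i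
  have hgap : M - (P *ᵥ v) i = ∑ l, P i l * (M - v l) := by
    simp only [mul_sub, Finset.sum_sub_distrib, ← Finset.sum_mul, hrow, one_mul]
    rfl
  have hsingle : P i j * (M - v j) ≤ ∑ l, P i l * (M - v l) :=
    Finset.single_le_sum (f := fun l => P i l * (M - v l))
      (fun l _ => mul_nonneg (nonneg_of_mem_rowStochastic hP) (sub_nonneg.2 (hv l)))
      (Finset.mem_univ j)
  have hδj : δ * (M - v j) ≤ P i j * (M - v j) :=
    mul_le_mul_of_nonneg_right (hδ i j) (sub_nonneg.2 (hv j))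
  linarith

lemma Matrix.mulVec_le_of_mem_rowStochastic_s14 (hP : P ∈ rowStochastic ℝ n) {M : ℝ}
    {v : n → ℝ} (hv : ∀ j, v j ≤ M) (i : n) : (P *ᵥ v) i ≤ M := by
  simpa using mulVec_le_sub_of_mem_rowStochastic hP
    (fun _ _ => nonneg_of_mem_rowStochastic hP) hv i i

lemma Matrix.le_mulVec_of_mem_rowStochastic_s14 (hP : P ∈ rowStochastic ℝ n) {m : ℝ}
    {v : n → ℝ} (hv : ∀ j, m ≤ v j) (i : n) : m ≤ (P *ᵥ v) i := by
  have h := mulVec_le_of_mem_rowStochastic_s14 hP (v := -v) (M := -m) (fun j => by simpa using hv j) i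
  simpa [mulVec_neg] using h

/-- Powers of a primitive row-stochastic matrix send every vector to a constant one in the
limit. -/
theorem Matrix.IsPrimitive.exists_tendsto_pow_mulVec_s14 [Nonempty n] (hP : P ∈ rowStochastic ℝ n)
    (hprim : P.IsPrimitive) (v : n → ℝ) :
    ∃ c : ℝ, ∀ i, Tendsto (fun k : ℕ => (P ^ k *ᵥ v) i) atTop (𝓝 c) := by
  obtain ⟨p, -, hp⟩ := hprim.exists_pos_pow
  obtain ⟨δ, hδ, hδP⟩ : ∃ δ > 0, ∀ i j, δ ≤ (P ^ p) i j := by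
    obtain ⟨x, hx⟩ := Finite.exists_min (fun x : n × n => (P ^ p) x.1 x.2)
    exact ⟨_, hp x.1 x.2, fun i j => hx (i, j)⟩
  have hadd (q k : ℕ) : P ^ (k + q) *ᵥ v = P ^ q *ᵥ (P ^ k *ᵥ v) := by
    rw [mulVec_mulVec, ← pow_add, add_comm]
  let M (k : ℕ) : ℝ := univ.sup' univ_nonempty (P ^ k *ᵥ v)
  let m (k : ℕ) : ℝ := univ.inf' univ_nonempty (P ^ k *ᵥ v)
  have hM (k i) : (P ^ k *ᵥ v) i ≤ M k := le_sup' (P ^ k *ᵥ v) (mem_univ i)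
  have hm (k i) : m k ≤ (P ^ k *ᵥ v) i := inf'_le (P ^ k *ᵥ v) (mem_univ i)
  have hmM (k) : m k ≤ M k := (hm k (Classical.arbitrary n)).trans (hM k _)
  have hManti : Antitone M := antitone_nat_of_succ_le fun k =>
    sup'_le _ _ fun i _ => by
      rw [hadd 1 k, pow_one]
      exact mulVec_le_of_mem_rowStochastic_s14 hP (hM k) i
  have hmmono : Monotone m := monotone_nat_of_le_succ fun k =>
    le_inf' _ _ fun i _ => by
      rw [hadd 1 k, pow_one]
      exact le_mulVec_of_mem_rowStochastic_s14 hP (hm k) i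
  have hMlim := tendsto_atTop_ciInf hManti
    ⟨m 0, by rintro _ ⟨k, rfl⟩; exact (hmmono k.zero_le).trans (hmM k)⟩
  have hmlim := tendsto_atTop_ciSup hmmono
    ⟨M 0, by rintro _ ⟨k, rfl⟩; exact (hmM k).trans (hManti k.zero_le)⟩
  have hcontr (k) : M (k + p) ≤ M k - δ * (M k - m k) :=
    sup'_le _ _ fun i _ => by
      obtain ⟨j, -, hj⟩ := exists_mem_eq_inf' univ_nonempty (P ^ k *ᵥ v)
      rw [hadd p k, show m k = (P ^ k *ᵥ v) j from hj]
      exact mulVec_le_sub_of_mem_rowStochastic (pow_mem hP p) hδP (hM k) i j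
  have hle := le_of_tendsto_of_tendsto' ((tendsto_add_atTop_iff_nat p).2 hMlim)
    (hMlim.sub ((hMlim.sub hmlim).const_mul δ)) hcontr
  have hge := le_of_tendsto_of_tendsto' hmlim hMlim hmM
  have heq : (⨆ k, m k) = ⨅ k, M k := le_antisymm hge (by nlinarith)
  rw [heq] at hmlim
  exact ⟨_, fun i => tendsto_of_tendsto_of_tendsto_of_le_of_le hmlim hMlim
    (fun k => hm k i) (fun k => hM k i)⟩

end RowStochastic

/-- A nonnegative matrix with positive diagonal whose off-diagonal support contains a connected
graph is primitive. -/
theorem SimpleGraph.Connected.isPrimitive {n : Type*} [Fintype n] [DecidableEq n]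
    {G : SimpleGraph n} (hG : G.Connected) {P : Matrix n n ℝ} (hnonneg : ∀ i j, 0 ≤ P i j)
    (hdiag : ∀ i, 0 < P i i) (hadj : ∀ i j, G.Adj i j → 0 < P i j) : P.IsPrimitive := by
  have hpow (k : ℕ) : ∀ i j, 0 ≤ (P ^ k) i j := by
    induction k with
    | zero => intro i j; rw [pow_zero, one_apply]; split_ifs <;> norm_num
    | succ k ih =>
      intro i j
      rw [pow_succ, mul_apply]
      exact sum_nonneg fun l _ => mul_nonneg (ih i l) (hnonneg l j)
  have hstep {k : ℕ} {i l j : n} (hil : 0 < P i l) (hlj : 0 < (P ^ k) l j) :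
      0 < (P ^ (k + 1)) i j := by
    rw [pow_succ', mul_apply]
    exact sum_pos' (fun x _ => mul_nonneg (hnonneg i x) (hpow k x j))
      ⟨l, mem_univ l, mul_pos hil hlj⟩
  have hmono {k q : ℕ} (hkq : k ≤ q) {i j : n} (h : 0 < (P ^ k) i j) : 0 < (P ^ q) i j := by
    induction hkq with
    | refl => exact h
    | step _ ih => exact hstep (hdiag i) ih
  have hwalk (i j : n) (w : G.Walk i j) : 0 < (P ^ w.length) i j := by
    induction w with
    | nil => simp
    | cons h _ ih => exact hstep (hadj _ _ h) ih
  let w (x : n × n) : G.Walk x.1 x.2 := (hG.preconnected x.1 x.2).some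
  refine ⟨hnonneg, univ.sup (fun x : n × n => (w x).length) + 1, Nat.succ_pos _, fun i j => ?_⟩
  exact hmono ((le_sup (f := fun x : n × n => (w x).length) (mem_univ (i, j))).trans
    (Nat.le_succ _)) (hwalk i j (w (i, j)))

/-- Let `G` be a connected finite simple graph on `N` vertices, `A' = A + I`,
`D'` the diagonal matrix of row sums of `A'`, `Â = (D')⁻¹A'`, and let `L(Z) = ReLU(ÂZ)` be the
GCN layer with identity weights (entrywise `max 0`). Then for every `Z ∈ ℝ^{N×C}` with
nonnegative entries, the iterates `L^k(Z)` converge (entrywise) as `k → ∞` to a matrix `Z̃`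
all of whose rows are equal: an infinite-depth GCN with identity linear mappings makes every
node's output vector identical. -/
theorem infinite_depth_gcn_rows_equal
    (N C : ℕ) (G : SimpleGraph (Fin N)) [DecidableRel G.Adj]
    (hconn : G.Connected)
    (A : Matrix (Fin N) (Fin N) ℝ) (hA : A = G.adjMatrix ℝ)
    (A' : Matrix (Fin N) (Fin N) ℝ) (hA' : A' = A + 1)
    (D' : Matrix (Fin N) (Fin N) ℝ) (hD' : D' = Matrix.diagonal (fun i => ∑ j, A' i j))
    (Ahat : Matrix (Fin N) (Fin N) ℝ) (hAhat : Ahat = D'⁻¹ * A')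
    (L : Matrix (Fin N) (Fin C) ℝ → Matrix (Fin N) (Fin C) ℝ)
    (hL : ∀ Z i j, L Z i j = max 0 ((Ahat * Z) i j))
    (Z : Matrix (Fin N) (Fin C) ℝ) (hZ : ∀ i j, 0 ≤ Z i j) :
    ∃ Ztilde : Matrix (Fin N) (Fin C) ℝ,
      (∀ i i', Ztilde i = Ztilde i')
      ∧ Tendsto (fun k : ℕ => L^[k] Z) atTop (𝓝 Ztilde) := by
  have : Nonempty (Fin N) := hconn.nonempty
  have hA'nonneg (i j) : 0 ≤ A' i j := by
    rw [hA', hA, Matrix.add_apply, SimpleGraph.adjMatrix_apply, Matrix.one_apply]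
    split_ifs <;> norm_num
  have hA'diag (i) : 0 < A' i i := by simp [hA', hA]
  have hA'adj (i j) (h : G.Adj i j) : 0 < A' i j := by simp [hA', hA, h, h.ne]
  have hd (i) : 0 < ∑ j, A' i j :=
    sum_pos' (fun j _ => hA'nonneg i j) ⟨i, mem_univ i, hA'diag i⟩
  have hDdet : IsUnit D'.det := by
    rw [hD', det_diagonal]
    exact (prod_pos fun i _ => hd i).ne'.isUnit
  have hentry (i j) : Ahat i j = A' i j / ∑ l, A' i l := by
    have h : D' * Ahat = A' := by rw [hAhat, mul_nonsing_inv_cancel_left _ _ hDdet]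
    rw [eq_div_iff (hd i).ne', mul_comm, ← diagonal_mul (fun i => ∑ l, A' i l), ← hD', h]
  have hnonneg (i j) : 0 ≤ Ahat i j := by
    rw [hentry]; exact div_nonneg (hA'nonneg i j) (hd i).le
  have hstoch : Ahat ∈ rowStochastic ℝ (Fin N) := by
    refine mem_rowStochastic_iff_sum.2 ⟨hnonneg, fun i => ?_⟩
    simp_rw [hentry, ← sum_div]
    exact div_self (hd i).ne'
  have hprim : Ahat.IsPrimitive := hconn.isPrimitive hnonneg
    (fun i => by rw [hentry]; exact div_pos (hA'diag i) (hd i))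
    (fun i j h => by rw [hentry]; exact div_pos (hA'adj i j h) (hd i))
  have hiter (k : ℕ) : L^[k] Z = Ahat ^ k * Z := by
    induction k with
    | zero => simp
    | succ k ih =>
      ext i j
      rw [Function.iterate_succ_apply', ih, hL, ← Matrix.mul_assoc, ← pow_succ', max_eq_right]
      rw [mul_apply]
      exact sum_nonneg fun l _ =>
        mul_nonneg (nonneg_of_mem_rowStochastic (pow_mem hstoch (k + 1))) (hZ l j)
  choose c hc using fun j => hprim.exists_tendsto_pow_mulVec_s14 hstoch (fun l => Z l j)
  refine ⟨fun _ j => c j, fun _ _ => rfl, ?_⟩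
  simp_rw [hiter]
  exact tendsto_pi_nhds.2 fun i => tendsto_pi_nhds.2 fun j => hc j i
end
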